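/- Let $g:\mathbb{R}\to\mathbb{R}$ be Lipschitz continuous with $g(0)=0$. Then for each right-continuous function $f:[0,\infty)\to\mathbb{R}$ with left limits, there exists a unique right-continuous function $x:[0,\infty)\to\mathbb{R}$ with left limits satisfying the integral equation $x(t)=f(t)-\int_0^t g(x(u))\,\mathrm{d}u$ for all $t\geq 0$. -/

import Mathlib

open MeasureTheory Set Filter

/-- Membership in the Skorokhod space `𝔻`: right-continuous on `[0,∞)` with
left limits on `(0,∞)`. -/
def IsRCLL (f : ℝ → ℝ) : Prop :=
  (∀ t : ℝ, 0 ≤ t → ContinuousWithinAt f (Set.Ici t) t) ∧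
  (∀ t : ℝ, 0 < t → ∃ L : ℝ, Tendsto f (nhdsWithin t (Set.Iio t)) (nhds L))

open scoped Topology BoundedContinuousFunction

/-- A real function that is right-continuous everywhere is Borel measurable. -/
theorem measurable_of_forall_continuousWithinAt_Ici {f : ℝ → ℝ}
    (hf : ∀ t, ContinuousWithinAt f (Ici t) t) : Measurable f := by
  have hmeas : ∀ n : ℕ, Measurable fun t : ℝ => f ((⌊((n : ℝ) + 1) * t⌋ + 1) / ((n : ℝ) + 1)) := by
    intro n
    have h1 : Measurable fun k : ℤ => f (((k : ℝ) + 1) / ((n : ℝ) + 1)) := measurable_from_top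
    exact h1.comp (Int.measurable_floor.comp (measurable_const_mul _))
  refine measurable_of_tendsto_metrizable hmeas (tendsto_pi_nhds.2 fun t => ?_)
  refine (hf t).tendsto.comp (tendsto_nhdsWithin_iff.2 ⟨?_, ?_⟩)
  · have h2 : Tendsto (fun n : ℕ => t + 1 / ((n : ℝ) + 1)) atTop (𝓝 t) := by
      simpa using tendsto_one_div_add_atTop_nhds_zero_nat.const_add t
    refine tendsto_of_tendsto_of_tendsto_of_le_of_le tendsto_const_nhds h2 (fun n => ?_) fun n => ?_
    · have hn : (0 : ℝ) < n + 1 := by positivity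
      rw [le_div_iff₀ hn]
      linarith [Int.lt_floor_add_one (((n : ℝ) + 1) * t)]
    · have hn : (0 : ℝ) < n + 1 := by positivity
      rw [div_le_iff₀ hn, add_mul t, one_div, inv_mul_cancel₀ hn.ne', mul_comm t]
      linarith [Int.floor_le (((n : ℝ) + 1) * t)]
  · refine Eventually.of_forall fun n => ?_
    have hn : (0 : ℝ) < n + 1 := by positivity
    rw [mem_Ici, le_div_iff₀ hn]
    linarith [Int.lt_floor_add_one (((n : ℝ) + 1) * t)]

/-- A real function with one-sided limits everywhere that is right-continuous is locally
integrable. -/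
theorem locallyIntegrable_of_rightContinuous_of_leftLim {f : ℝ → ℝ}
    (hf : ∀ t, ContinuousWithinAt f (Ici t) t)
    (hl : ∀ t, ∃ l : ℝ, Tendsto f (𝓝[<] t) (𝓝 l)) : LocallyIntegrable f := by
  have hm : AEStronglyMeasurable f :=
    (measurable_of_forall_continuousWithinAt_Ici hf).aestronglyMeasurable
  intro t
  obtain ⟨l, hl⟩ := hl t
  rw [← nhdsLT_sup_nhdsGE, IntegrableAtFilter.sup_iff]
  exact ⟨hl.integrableAtFilter hm.stronglyMeasurableAtFilter
      (volume.finiteAt_nhdsWithin t _),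
    (hf t).tendsto.integrableAtFilter hm.stronglyMeasurableAtFilter
      (volume.finiteAt_nhdsWithin t _)⟩

/-- The extension of an RCLL function on `[0,∞)` by zero is locally integrable. -/
theorem IsRCLL.locallyIntegrable_indicator {f : ℝ → ℝ} (hf : IsRCLL f) :
    LocallyIntegrable ((Ici 0).indicator f) := by
  have hneg : ∀ t : ℝ, t < 0 → (Ici 0).indicator f =ᶠ[𝓝 t] fun _ => 0 := by
    intro t ht
    filter_upwards [Iio_mem_nhds ht] with s hs
    exact indicator_of_notMem (by simpa using hs) f
  refine locallyIntegrable_of_rightContinuous_of_leftLim (fun t => ?_) fun t => ?_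
  · rcases lt_or_ge t 0 with ht | ht
    · exact (continuousAt_const.congr (hneg t ht).symm).continuousWithinAt
    · exact (hf.1 t ht).congr (fun s hs => indicator_of_mem (ht.trans hs) f)
        (indicator_of_mem ht f)
  · rcases le_or_gt t 0 with ht | ht
    · refine ⟨0, tendsto_const_nhds.congr' ?_⟩
      filter_upwards [self_mem_nhdsWithin] with s hs
      exact (indicator_of_notMem (by simpa using lt_of_lt_of_le hs ht) f).symm
    · obtain ⟨l, hl⟩ := hf.2 t ht
      refine ⟨l, hl.congr' ?_⟩
      filter_upwards [mem_nhdsWithin_of_mem_nhds (Ioi_mem_nhds ht)] with s hs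
      exact (indicator_of_mem (le_of_lt hs) f).symm

theorem MeasureTheory.LocallyIntegrable.intervalIntegrable {f : ℝ → ℝ} (hf : LocallyIntegrable f)
    {a b : ℝ} : IntervalIntegrable f volume a b :=
  (hf.integrableOn_isCompact isCompact_uIcc).intervalIntegrable

theorem IsRCLL.intervalIntegrable {f : ℝ → ℝ} (hf : IsRCLL f) {a b : ℝ} (ha : 0 ≤ a)
    (hb : 0 ≤ b) : IntervalIntegrable f volume a b := by
  refine (hf.locallyIntegrable_indicator.intervalIntegrable (a := a) (b := b)).congr
    fun t ht => indicator_of_mem ?_ f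
  exact (le_min ha hb).trans (le_of_lt ht.1)

theorem IsRCLL.add_continuous {f z : ℝ → ℝ} (hf : IsRCLL f) (hz : Continuous z) :
    IsRCLL fun t => f t + z t := by
  refine ⟨fun t ht => (hf.1 t ht).add hz.continuousWithinAt, fun t ht => ?_⟩
  obtain ⟨l, hl⟩ := hf.2 t ht
  exact ⟨l + z t, hl.add hz.continuousWithinAt⟩

theorem IsRCLL.continuous_comp {f g : ℝ → ℝ} (hf : IsRCLL f) (hg : Continuous g) :
    IsRCLL fun t => g (f t) := by
  refine ⟨fun t ht => hg.continuousAt.comp_continuousWithinAt (hf.1 t ht), fun t ht => ?_⟩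
  obtain ⟨l, hl⟩ := hf.2 t ht
  exact ⟨g l, (hg.tendsto l).comp hl⟩

theorem LipschitzWith.abs_le_mul_abs {g : ℝ → ℝ} {L : NNReal} (hg : LipschitzWith L g)
    (hg0 : g 0 = 0) (x : ℝ) : |g x| ≤ L * |x| := by
  simpa [hg0] using hg.norm_sub_le x 0

theorem LipschitzWith.comp_intervalIntegrable {g : ℝ → ℝ} {L : NNReal} (hg : LipschitzWith L g)
    (hg0 : g 0 = 0) {h : ℝ → ℝ} {a b : ℝ} (hh : IntervalIntegrable h volume a b) :
    IntervalIntegrable (fun u => g (h u)) volume a b := by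
  rw [intervalIntegrable_iff, IntegrableOn, ← memLp_one_iff_integrable] at hh ⊢
  exact hg.comp_memLp hg0 hh

section Existence

/-- The weight `exp ((2 L + 1) t) * (1 + ∫₀ᵗ |f|)` for which the integral operator is a
contraction. -/
noncomputable def picardWeight (L : NNReal) (f : ℝ → ℝ) (t : ℝ) : ℝ :=
  Real.exp ((2 * L + 1) * t) * (1 + ∫ u in (0:ℝ)..t, |f u|)

variable {L : NNReal} {f : ℝ → ℝ}

theorem continuous_picardWeight (hf : LocallyIntegrable f) : Continuous (picardWeight L f) := by
  have h : Continuous fun t => ∫ u in (0:ℝ)..t, |f u| :=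
    intervalIntegral.continuous_primitive
      (fun a b => (hf.intervalIntegrable (a := a) (b := b)).abs) 0
  unfold picardWeight
  fun_prop

theorem integral_abs_le_picardWeight {t : ℝ} (ht : 0 ≤ t) :
    ∫ u in (0:ℝ)..t, |f u| ≤ picardWeight L f t := by
  have h0 : 0 ≤ ∫ u in (0:ℝ)..t, |f u| :=
    intervalIntegral.integral_nonneg ht fun _ _ => abs_nonneg _
  have h1 : 1 ≤ Real.exp ((2 * L + 1) * t) := Real.one_le_exp (by positivity)
  unfold picardWeight
  nlinarith

theorem picardWeight_pos {t : ℝ} (ht : 0 ≤ t) : 0 < picardWeight L f t := by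
  have h0 : 0 ≤ ∫ u in (0:ℝ)..t, |f u| :=
    intervalIntegral.integral_nonneg ht fun _ _ => abs_nonneg _
  unfold picardWeight
  positivity

theorem mul_integral_picardWeight_le (hf : LocallyIntegrable f) {t : ℝ} (ht : 0 ≤ t) :
    L * ∫ u in (0:ℝ)..t, picardWeight L f u ≤ picardWeight L f t / 2 := by
  set A := 1 + ∫ u in (0:ℝ)..t, |f u|
  have hA0 : 0 ≤ A := by
    have : 0 ≤ ∫ u in (0:ℝ)..t, |f u| :=
      intervalIntegral.integral_nonneg ht fun _ _ => abs_nonneg _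
    positivity
  have hL : (0 : ℝ) ≤ L := L.2
  have hc : (2 * L + 1 : ℝ) ≠ 0 := by positivity
  have hint : ∫ u in (0:ℝ)..t, picardWeight L f u ≤
      ∫ u in (0:ℝ)..t, Real.exp ((2 * L + 1) * u) * A := by
    refine intervalIntegral.integral_mono_on ht
      ((continuous_picardWeight hf).intervalIntegrable _ _)
      (Continuous.intervalIntegrable (by fun_prop) _ _) fun u hu => ?_
    refine mul_le_mul_of_nonneg_left ?_ (Real.exp_pos _).le
    refine add_le_add_right ?_ 1
    exact intervalIntegral.integral_mono_interval le_rfl hu.1 hu.2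
      (Eventually.of_forall fun _ => abs_nonneg _) hf.intervalIntegrable.abs
  have hexp : ∫ u in (0:ℝ)..t, Real.exp ((2 * L + 1) * u) * A =
      (Real.exp ((2 * L + 1) * t) - 1) / (2 * L + 1) * A := by
    rw [intervalIntegral.integral_mul_const, intervalIntegral.integral_comp_mul_left _ hc,
      integral_exp]
    simp [div_eq_inv_mul]
  have hW : picardWeight L f t = Real.exp ((2 * L + 1) * t) * A := rfl
  have hE : 1 ≤ Real.exp ((2 * L + 1) * t) := Real.one_le_exp (by positivity)
  calc L * ∫ u in (0:ℝ)..t, picardWeight L f u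
      ≤ L * ((Real.exp ((2 * L + 1) * t) - 1) / (2 * L + 1) * A) := by
        rw [← hexp]
        exact mul_le_mul_of_nonneg_left hint hL
    _ = L * (Real.exp ((2 * L + 1) * t) - 1) / (2 * L + 1) * A := by ring
    _ ≤ Real.exp ((2 * L + 1) * t) / 2 * A := by
        refine mul_le_mul_of_nonneg_right ?_ hA0
        rw [div_le_div_iff₀ (by positivity) two_pos]
        nlinarith
    _ = picardWeight L f t / 2 := by rw [hW]; ring

/-- For locally integrable `f`, the equation for the continuous part `z = x - f` of the solution
is solvable. -/
theorem exists_continuous_eq_neg_integral {g : ℝ → ℝ} (hg : LipschitzWith L g) (hg0 : g 0 = 0)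
    (hf : LocallyIntegrable f) :
    ∃ z : ℝ → ℝ, Continuous z ∧ ∀ t, 0 ≤ t → z t = -∫ u in (0:ℝ)..t, g (f u + z u) := by
  set W := picardWeight L f
  have hWc : Continuous W := continuous_picardWeight hf
  have hint : ∀ (φ : NNReal →ᵇ ℝ) (a b : ℝ),
      IntervalIntegrable (fun u => g (f u + W u * φ u.toNNReal)) volume a b := by
    intro φ a b
    refine hg.comp_intervalIntegrable hg0 (hf.intervalIntegrable.add ?_)
    exact Continuous.intervalIntegrable (by fun_prop) _ _
  have hcont : ∀ φ : NNReal →ᵇ ℝ,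
      Continuous fun t => ∫ u in (0:ℝ)..t, g (f u + W u * φ u.toNNReal) :=
    fun φ => intervalIntegral.continuous_primitive (hint φ) 0
  have hbound : ∀ (φ : NNReal →ᵇ ℝ) (s : NNReal),
      ‖-(∫ u in (0:ℝ)..s, g (f u + W u * φ u.toNNReal)) / W s‖ ≤ L + ‖φ‖ / 2 := by
    intro φ s
    have hs : (0 : ℝ) ≤ s := s.2
    have hWs : 0 < W s := picardWeight_pos hs
    rw [norm_div, norm_neg, Real.norm_of_nonneg hWs.le, div_le_iff₀ hWs]
    calc ‖∫ u in (0:ℝ)..s, g (f u + W u * φ u.toNNReal)‖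
        ≤ ∫ u in (0:ℝ)..s, (L * |f u| + ‖φ‖ * L * W u) := by
          refine intervalIntegral.norm_integral_le_of_norm_le hs
            (Eventually.of_forall fun u hu => ?_)
            ((hf.intervalIntegrable.abs.const_mul _).add
              (Continuous.intervalIntegrable (by fun_prop) _ _))
          have h0 : 0 ≤ W u := (picardWeight_pos hu.1.le).le
          have h1 := hg.abs_le_mul_abs hg0 (f u + W u * φ u.toNNReal)
          have h2 := abs_add_le (f u) (W u * φ u.toNNReal)
          have h3 : |W u * φ u.toNNReal| ≤ W u * ‖φ‖ := by
            rw [abs_mul, abs_of_nonneg h0]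
            exact mul_le_mul_of_nonneg_left (φ.norm_coe_le_norm _) h0
          rw [Real.norm_eq_abs]
          calc _ ≤ _ := h1
            _ ≤ L * (|f u| + W u * ‖φ‖) := by gcongr; linarith
            _ = _ := by ring
      _ = L * (∫ u in (0:ℝ)..s, |f u|) + ‖φ‖ * (L * ∫ u in (0:ℝ)..s, W u) := by
          rw [intervalIntegral.integral_add (hf.intervalIntegrable.abs.const_mul _)
            (Continuous.intervalIntegrable (by fun_prop) _ _),
            intervalIntegral.integral_const_mul, intervalIntegral.integral_const_mul, mul_assoc]
      _ ≤ L * W s + ‖φ‖ * (W s / 2) := by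
          gcongr
          · exact integral_abs_le_picardWeight hs
          · exact mul_integral_picardWeight_le hf hs
      _ = (L + ‖φ‖ / 2) * W s := by ring
  let T : (NNReal →ᵇ ℝ) → (NNReal →ᵇ ℝ) := fun φ =>
    BoundedContinuousFunction.ofNormedAddCommGroup
      (fun s : NNReal => -(∫ u in (0:ℝ)..s, g (f u + W u * φ u.toNNReal)) / W s)
      (((hcont φ).comp NNReal.continuous_coe).neg.div (hWc.comp NNReal.continuous_coe)
        fun s => (picardWeight_pos s.2).ne') _ (hbound φ)
  have hT : ContractingWith (1 / 2) T := by
    refine ⟨NNReal.half_lt_self one_ne_zero, LipschitzWith.of_dist_le_mul fun φ ψ => ?_⟩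
    refine (BoundedContinuousFunction.dist_le (by positivity)).2 fun s => ?_
    have hs : (0 : ℝ) ≤ s := s.2
    have hWs : 0 < W s := picardWeight_pos hs
    change dist (-(∫ u in (0:ℝ)..s, g (f u + W u * φ u.toNNReal)) / W s)
      (-(∫ u in (0:ℝ)..s, g (f u + W u * ψ u.toNNReal)) / W s) ≤ _
    rw [Real.dist_eq, ← sub_div, abs_div, abs_of_pos hWs, div_le_iff₀ hWs, neg_sub_neg, abs_sub_comm,
      ← intervalIntegral.integral_sub (hint φ _ _) (hint ψ _ _), ← Real.norm_eq_abs]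
    calc _ ≤ ∫ u in (0:ℝ)..s, dist φ ψ * L * W u := by
          refine intervalIntegral.norm_integral_le_of_norm_le hs
            (Eventually.of_forall fun u hu => ?_)
            (Continuous.intervalIntegrable (by fun_prop) _ _)
          have h0 : 0 ≤ W u := (picardWeight_pos hu.1.le).le
          refine (hg.norm_sub_le _ _).trans ?_
          rw [add_sub_add_left_eq_sub, ← mul_sub, norm_mul, Real.norm_of_nonneg h0, ← dist_eq_norm]
          calc _ ≤ L * (W u * dist φ ψ) := by
                gcongr
                exact BoundedContinuousFunction.dist_coe_le_dist _
            _ = _ := by ring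
      _ = dist φ ψ * (L * ∫ u in (0:ℝ)..s, W u) := by
          rw [intervalIntegral.integral_const_mul, mul_assoc]
      _ ≤ dist φ ψ * (W s / 2) := by
          gcongr
          exact mul_integral_picardWeight_le hf hs
      _ = _ := by
          push_cast
          ring
  obtain ⟨φ, hφ⟩ : ∃ φ, T φ = φ := ⟨_, hT.fixedPoint_isFixedPt⟩
  refine ⟨fun u => W u * φ u.toNNReal, by fun_prop, fun t ht => ?_⟩
  have h := DFunLike.congr_fun hφ t.toNNReal
  change -(∫ u in (0:ℝ)..(t.toNNReal : ℝ), g (f u + W u * φ u.toNNReal)) / W (t.toNNReal : ℝ) = _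
    at h
  rw [Real.coe_toNNReal t ht] at h
  have hWt : W t ≠ 0 := (picardWeight_pos ht).ne'
  simp only
  rw [← h]
  field_simp

end Existence

/-- Grönwall's inequality in integral form, in the homogeneous case, for right-continuous
functions. -/
theorem IsRCLL.eqOn_zero_of_abs_le_mul_integral {d : ℝ → ℝ} (hd : IsRCLL d) {K : ℝ}
    (h : ∀ t, 0 ≤ t → |d t| ≤ K * ∫ u in (0:ℝ)..t, |d u|) : EqOn d 0 (Ici 0) := by
  have hd' : IsRCLL fun t => |d t| := hd.continuous_comp continuous_abs
  intro T hT
  have hz := eq_zero_of_abs_deriv_le_mul_abs_self_of_eq_zero_right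
    (f := fun t => ∫ u in (0:ℝ)..t, |d u|) (f' := fun t => |d t|) (K := K) (a := 0) (b := T)
    ?_ ?_ (by simp) ?_ T ⟨hT, le_rfl⟩
  · have := h T hT
    rw [hz, mul_zero] at this
    exact abs_nonpos_iff.1 this
  · have := intervalIntegral.continuousOn_primitive_interval (μ := volume) (a := 0) (b := T)
      (f := fun t => |d t|) (((intervalIntegrable_iff' (by simp)).1 (hd'.intervalIntegrable le_rfl hT)))
    rwa [uIcc_of_le hT] at this
  · intro t ht
    refine intervalIntegral.integral_hasDerivWithinAt_right (t := Ioi t)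
      (hd'.intervalIntegrable le_rfl ht.1) ?_ ((hd'.1 t ht.1).mono Ioi_subset_Ici_self)
    refine ⟨Ioc t (t + 1), Ioc_mem_nhdsGT (by linarith), ?_⟩
    exact ((intervalIntegrable_iff_integrableOn_Ioc_of_le (by linarith)).1
      (hd'.intervalIntegrable ht.1 (by linarith [ht.1]))).aestronglyMeasurable
  · intro t ht
    have h0 : 0 ≤ ∫ u in (0:ℝ)..t, |d u| :=
      intervalIntegral.integral_nonneg ht.1 fun _ _ => abs_nonneg _
    simpa [abs_of_nonneg h0] using h t ht.1

theorem IsRCLL.sub {x y : ℝ → ℝ} (hx : IsRCLL x) (hy : IsRCLL y) : IsRCLL fun t => x t - y t := by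
  refine ⟨fun t ht => (hx.1 t ht).sub (hy.1 t ht), fun t ht => ?_⟩
  obtain ⟨l, hl⟩ := hx.2 t ht
  obtain ⟨m, hm⟩ := hy.2 t ht
  exact ⟨l - m, hl.sub hm⟩

/-- For Lipschitz `g` with `g 0 = 0` and each RCLL `f`, the integral equation
`x(t) = f(t) - ∫₀ᵗ g(x(u)) du` has a solution `x ∈ 𝔻`, unique on `[0,∞)`. -/
theorem stmt0 (g : ℝ → ℝ) (L : NNReal) (hg : LipschitzWith L g) (hg0 : g 0 = 0)
    (f : ℝ → ℝ) (hf : IsRCLL f) :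
    ∃ x : ℝ → ℝ,
      (IsRCLL x ∧ ∀ t : ℝ, 0 ≤ t → x t = f t - ∫ u in (0:ℝ)..t, g (x u)) ∧
      ∀ y : ℝ → ℝ,
        (IsRCLL y ∧ ∀ t : ℝ, 0 ≤ t → y t = f t - ∫ u in (0:ℝ)..t, g (y u)) →
        Set.EqOn y x (Set.Ici 0) := by
  obtain ⟨z, hzc, hz⟩ := exists_continuous_eq_neg_integral hg hg0 hf.locallyIntegrable_indicator
  have hx : IsRCLL fun t => f t + z t := hf.add_continuous hzc
  have hxe : ∀ t : ℝ, 0 ≤ t → f t + z t = f t - ∫ u in (0:ℝ)..t, g (f u + z u) := by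
    intro t ht
    rw [hz t ht, ← sub_eq_add_neg]
    congr 1
    refine intervalIntegral.integral_congr fun u hu => ?_
    rw [uIcc_of_le ht] at hu
    simp only [indicator_of_mem (show u ∈ Ici (0 : ℝ) from hu.1)]
  refine ⟨fun t => f t + z t, ⟨hx, hxe⟩, fun y ⟨hy, hye⟩ => ?_⟩
  have hd := hy.sub hx
  have hzero := hd.eqOn_zero_of_abs_le_mul_integral (K := L) fun t ht => ?_
  · exact fun t ht => sub_eq_zero.1 (hzero ht)
  · have hgx := hg.comp_intervalIntegrable hg0 (hx.intervalIntegrable le_rfl ht)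
    have hgy := hg.comp_intervalIntegrable hg0 (hy.intervalIntegrable le_rfl ht)
    rw [hye t ht, hxe t ht, sub_sub_sub_cancel_left, ← intervalIntegral.integral_sub hgx hgy,
      ← intervalIntegral.integral_const_mul, ← Real.norm_eq_abs]
    refine intervalIntegral.norm_integral_le_of_norm_le ht (Eventually.of_forall fun u _ => ?_)
      ((hd.intervalIntegrable le_rfl ht).abs.const_mul _)
    rw [abs_sub_comm]
    exact hg.norm_sub_le _ _
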